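/- arXiv:2010.07228 — 5 statements merged into one kernel-verified Lean document; each statement's English description precedes it below -/
import Mathlib

section
/- Let S be a finite set, μ a probability mass function on S, and for each s ∈ S let p_s ∈ [0,1] and set m_s = max(p_s, 1−p_s). Then Σ_{s∈S} μ(s)·2·(1 − m_s) ≤ sqrt( 2·ln 2 · H ), where H = Σ_{s∈S} μ(s)·h(p_s) and h(p) = −p·log₂ p − (1−p)·log₂(1−p) is the binary entropy function with 0·log₂ 0 = 0. -/
open scoped BigOperators

/-- `x·log₂ x` with the convention `0·log₂ 0 = 0` (negated). -/
noncomputable def negMulLog2 (x : ℝ) : ℝ := if x = 0 then 0 else -(x * Real.logb 2 x)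

/-- Binary entropy function `h(p) = −p·log₂ p − (1−p)·log₂(1−p)` in bits,
with the convention `0·log₂ 0 = 0`. -/
noncomputable def binEnt (p : ℝ) : ℝ := negMulLog2 p + negMulLog2 (1 - p)

lemma aux_negMulLog2 (x : ℝ) (hx : 0 ≤ x) : x * (1 - x) ≤ Real.log 2 * negMulLog2 x := by
  unfold negMulLog2
  split_ifs with h
  · simp [h]
  · have hx' : 0 < x := lt_of_le_of_ne hx (Ne.symm h)
    have h2 : Real.log 2 ≠ 0 := (Real.log_pos (by norm_num)).ne'
    have h1 := Real.log_le_sub_one_of_pos hx'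
    have h3 : Real.log 2 * -(x * Real.logb 2 x) = -(x * Real.log x) := by
      unfold Real.logb
      field_simp
    rw [h3]
    nlinarith

lemma aux_point (p : ℝ) (h0 : 0 ≤ p) (h1 : p ≤ 1) :
    (2 * (1 - max p (1 - p))) ^ 2 ≤ 2 * Real.log 2 * binEnt p := by
  have a := aux_negMulLog2 p h0
  have b := aux_negMulLog2 (1 - p) (by linarith)
  unfold binEnt
  rcases max_cases p (1 - p) with ⟨h, h'⟩ | ⟨h, h'⟩ <;> rw [h] <;> nlinarith

/-- Low-entropy per-index bound in the proof of Lemma 3 of the paper: with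
`m_s = max(p_s, 1−p_s)`, the `μ`-average of twice the total variation distance
between `(p_s, 1−p_s)` and the point mass at the most likely value is at most
`sqrt(2·ln 2·H(U|S))`, where `H(U|S) = ∑_s μ(s)·h(p_s)`. -/
theorem low_entropy_l1_bound {S : Type*} [Fintype S]
    (μ : S → ℝ) (hμ0 : ∀ s, 0 ≤ μ s) (hμ1 : ∑ s, μ s = 1)
    (p : S → ℝ) (hp0 : ∀ s, 0 ≤ p s) (hp1 : ∀ s, p s ≤ 1) :
    ∑ s, μ s * (2 * (1 - max (p s) (1 - p s))) ≤
      Real.sqrt (2 * Real.log 2 * ∑ s, μ s * binEnt (p s)) := by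
  apply Real.le_sqrt_of_sq_le
  refine (Real.pow_arith_mean_le_arith_mean_pow Finset.univ μ
    (fun s => 2 * (1 - max (p s) (1 - p s))) (fun s _ => hμ0 s) hμ1 ?_ 2).trans ?_
  · intro s _
    have := max_le (hp1 s) (show 1 - p s ≤ 1 by linarith [hp0 s])
    linarith
  · rw [Finset.mul_sum]
    refine Finset.sum_le_sum fun s _ => ?_
    have := mul_le_mul_of_nonneg_left (aux_point (p s) (hp0 s) (hp1 s)) (hμ0 s)
    linarith
end

section
/- Let S be a finite set, μ a probability mass function on S, and for each s ∈ S let p_s ∈ [0,1]. Define the Bhattacharyya parameter Z = 2·Σ_{s∈S} μ(s)·sqrt(p_s·(1−p_s)). If Z ≥ 1 − δ for some δ ∈ [0,1], then Σ_{s∈S} μ(s)·( |p_s − 1/2| + |(1−p_s) − 1/2| ) ≤ sqrt( 4·ln 2 · δ ). -/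
open scoped BigOperators

/-- High-Bhattacharyya (almost completely noisy bit-channel) per-index estimate
in the proof of Lemma 3 of the paper: if the conditional Bhattacharyya parameter
`Z = 2·∑_s μ(s)·sqrt(p_s(1−p_s))` satisfies `Z ≥ 1 − δ`, then the `μ`-average of
the L1 distance between `(p_s, 1−p_s)` and the uniform distribution on `{0,1}`
is at most `sqrt(4·ln 2·δ)`. -/
theorem high_bhattacharyya_l1_bound {S : Type*} [Fintype S]
    (μ : S → ℝ) (hμ0 : ∀ s, 0 ≤ μ s) (hμ1 : ∑ s, μ s = 1)
    (p : S → ℝ) (hp0 : ∀ s, 0 ≤ p s) (hp1 : ∀ s, p s ≤ 1)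
    (δ : ℝ) (hδ0 : 0 ≤ δ) (hδ1 : δ ≤ 1)
    (hZ : 1 - δ ≤ 2 * ∑ s, μ s * Real.sqrt (p s * (1 - p s))) :
    ∑ s, μ s * (|p s - 1 / 2| + |(1 - p s) - 1 / 2|) ≤
      Real.sqrt (4 * Real.log 2 * δ) := by
  set D := ∑ s, μ s * (|p s - 1 / 2| + |(1 - p s) - 1 / 2|) with hD
  clear_value D
  apply Real.le_sqrt_of_sq_le
  have key : ∀ s, μ s * (2 * D * (|p s - 1 / 2| + |(1 - p s) - 1 / 2|) - D ^ 2) ≤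
      μ s * (2 - 4 * Real.sqrt (p s * (1 - p s))) := by
    intro s
    apply mul_le_mul_of_nonneg_left _ (hμ0 s)
    have hr := Real.sq_sqrt (mul_nonneg (hp0 s) (sub_nonneg.2 (hp1 s)))
    have e : |(1 - p s) - 1 / 2| = |p s - 1 / 2| := by
      rw [← abs_neg]; congr 1; ring
    have ha := sq_abs (p s - 1 / 2)
    rw [e]
    nlinarith [sq_nonneg (D - 2 * |p s - 1 / 2|),
      sq_nonneg (1 - 2 * Real.sqrt (p s * (1 - p s)))]
  have hsum := Finset.sum_le_sum (fun s (_ : s ∈ Finset.univ) => key s)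
  have h1 : ∑ s, μ s * (2 * D * (|p s - 1 / 2| + |(1 - p s) - 1 / 2|) - D ^ 2)
      = 2 * D * D - D ^ 2 := by
    calc _ = 2 * D * (∑ s, μ s * (|p s - 1 / 2| + |(1 - p s) - 1 / 2|))
          - D ^ 2 * ∑ s, μ s := by
          rw [Finset.mul_sum, Finset.mul_sum, ← Finset.sum_sub_distrib]
          exact Finset.sum_congr rfl (fun s _ => by ring)
      _ = _ := by rw [hμ1, ← hD]; ring
  have h2 : ∑ s, μ s * (2 - 4 * Real.sqrt (p s * (1 - p s)))
      = 2 - 4 * ∑ s, μ s * Real.sqrt (p s * (1 - p s)) := by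
    calc _ = 2 * (∑ s, μ s) - 4 * ∑ s, μ s * Real.sqrt (p s * (1 - p s)) := by
          rw [Finset.mul_sum, Finset.mul_sum, ← Finset.sum_sub_distrib]
          exact Finset.sum_congr rfl (fun s _ => by ring)
      _ = _ := by rw [hμ1]; ring
  rw [h1, h2] at hsum
  have hl : 1 / 2 ≤ Real.log 2 := by linarith [Real.log_two_gt_d9]
  nlinarith [mul_le_mul_of_nonneg_right hl hδ0]
end

section
/- Let S be a finite set, μ a probability mass function on S, and for each s ∈ S let p_s ∈ [0,1] and set m_s = max(p_s, 1−p_s). Define the Bhattacharyya parameter Z = 2·Σ_{s∈S} μ(s)·sqrt(p_s·(1−p_s)). If Z ≤ δ for some δ ≥ 0, then Σ_{s∈S} μ(s)·2·(1 − m_s) ≤ sqrt( 2·ln 2 · δ ). -/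
open scoped BigOperators

/-- Low-Bhattacharyya (almost noiseless bit-channel) per-index estimate in the
proof of Lemma 3 of the paper: if the conditional Bhattacharyya parameter
`Z = 2·∑_s μ(s)·sqrt(p_s(1−p_s))` satisfies `Z ≤ δ`, then with
`m_s = max(p_s, 1−p_s)` the `μ`-average of twice the total variation distance
between `(p_s, 1−p_s)` and the point mass at the most likely value is at most
`sqrt(2·ln 2·δ)`. -/
theorem low_bhattacharyya_l1_bound {S : Type*} [Fintype S]
    (μ : S → ℝ) (hμ0 : ∀ s, 0 ≤ μ s) (hμ1 : ∑ s, μ s = 1)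
    (p : S → ℝ) (hp0 : ∀ s, 0 ≤ p s) (hp1 : ∀ s, p s ≤ 1)
    (δ : ℝ) (hδ0 : 0 ≤ δ)
    (hZ : 2 * ∑ s, μ s * Real.sqrt (p s * (1 - p s)) ≤ δ) :
    ∑ s, μ s * (2 * (1 - max (p s) (1 - p s))) ≤
      Real.sqrt (2 * Real.log 2 * δ) := by
  have hq : ∀ s, 0 ≤ 1 - max (p s) (1 - p s) ∧ 2 * (1 - max (p s) (1 - p s)) ≤ 1 ∧
      1 - max (p s) (1 - p s) ≤ Real.sqrt (p s * (1 - p s)) := by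
    intro s
    have h0 := hp0 s
    have h1 := hp1 s
    rcases le_total (p s) (1 - p s) with h | h
    · rw [max_eq_right h]
      refine ⟨by linarith, by linarith, Real.le_sqrt_of_sq_le ?_⟩
      nlinarith
    · rw [max_eq_left h]
      refine ⟨by linarith, by linarith, Real.le_sqrt_of_sq_le ?_⟩
      nlinarith
  have hA0 : 0 ≤ ∑ s, μ s * (2 * (1 - max (p s) (1 - p s))) :=
    Finset.sum_nonneg fun s _ => mul_nonneg (hμ0 s) (by linarith [(hq s).1])
  have hA1 : ∑ s, μ s * (2 * (1 - max (p s) (1 - p s))) ≤ 1 := by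
    refine le_trans ?_ hμ1.le
    exact Finset.sum_le_sum fun s _ => mul_le_of_le_one_right (hμ0 s) (hq s).2.1
  have hAZ : ∑ s, μ s * (2 * (1 - max (p s) (1 - p s))) ≤ δ := by
    refine le_trans ?_ hZ
    rw [Finset.mul_sum]
    refine Finset.sum_le_sum fun s _ => ?_
    have := mul_le_mul_of_nonneg_left (hq s).2.2 (hμ0 s)
    linarith
  have hlog := Real.log_two_gt_d9
  apply Real.le_sqrt_of_sq_le
  have h2 : δ ≤ 2 * Real.log 2 * δ := le_mul_of_one_le_left hδ0 (by linarith)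
  nlinarith
end

section
/- Let N ≥ 1, let P be a probability mass function on {0,1}^N, and for each i ∈ {1,…,N} and each prefix u^{1:i−1} with P(u^{1:i−1}) > 0 let p_i(·|u^{1:i−1}) denote the conditional distribution of the i-th bit under P. For each i define the Bhattacharyya parameter Z_i = 2·Σ_{u^{1:i−1}} P(u^{1:i−1})·sqrt( p_i(0|u^{1:i−1})·p_i(1|u^{1:i−1}) ). Let δ ∈ [0,1] and suppose {1,…,N} is partitioned into three sets 𝓗, 𝓛, 𝓡 with Z_i ≥ 1 − δ for all i ∈ 𝓗 and Z_i ≤ δ for all i ∈ 𝓛. Define Q on {0,1}^N as the product Q(u^{1:N}) = ∏_{i=1}^N q_i(u_i|u^{1:i−1}) of conditional kernels q_i, where: for i ∈ 𝓗, q_i(·|u^{1:i−1}) is uniform on {0,1}; for i ∈ 𝓛 and P(u^{1:i−1}) > 0, q_i(·|u^{1:i−1}) is the point mass at a value of u maximizing p_i(u|u^{1:i−1}) (ties broken arbitrarily); for i ∈ 𝓡 and P(u^{1:i−1}) > 0, q_i(·|u^{1:i−1}) = p_i(·|u^{1:i−1}); and q_i(·|u^{1:i−1}) is uniform whenever P(u^{1:i−1})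 = 0. Then Σ_{u^{1:N}} |P(u^{1:N}) − Q(u^{1:N})| ≤ 2·N·sqrt( ln 2 · δ ). -/
open scoped BigOperators

/-- Probability `P(u^{1:i-1} = u)` of a prefix `u` of length `i` under a pmf `P`
on `{0,1}^N`. -/
noncomputable def bMargin {N : ℕ} (P : (Fin N → Bool) → ℝ) (i : Fin N)
    (u : Fin i.val → Bool) : ℝ :=
  ∑ x ∈ Finset.univ.filter
      (fun x : Fin N → Bool => ∀ j : Fin i.val, x (Fin.castLE i.isLt.le j) = u j), P x

/-- Probability `P(u^{1:i-1} = u, u_i = b)` under a pmf `P` on `{0,1}^N`. -/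
noncomputable def bMarginWith {N : ℕ} (P : (Fin N → Bool) → ℝ) (i : Fin N)
    (u : Fin i.val → Bool) (b : Bool) : ℝ :=
  ∑ x ∈ Finset.univ.filter
      (fun x : Fin N → Bool =>
        (∀ j : Fin i.val, x (Fin.castLE i.isLt.le j) = u j) ∧ x i = b), P x

/-- Conditional probability `p_i(b | u) = P(u^{1:i-1} = u, u_i = b)/P(u^{1:i-1} = u)`
of the `i`-th bit given the prefix `u` (junk value `0` when the prefix has zero
probability, by real division-by-zero conventions). -/
noncomputable def bCond {N : ℕ} (P : (Fin N → Bool) → ℝ) (i : Fin N)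
    (u : Fin i.val → Bool) (b : Bool) : ℝ :=
  bMarginWith P i u b / bMargin P i u

/-- The Bhattacharyya parameter
`Z_i = 2·∑_{u^{1:i-1}} P(u^{1:i-1})·sqrt(p_i(0|u^{1:i-1})·p_i(1|u^{1:i-1}))`
of the `i`-th bit-channel of a pmf `P` on `{0,1}^N`. -/
noncomputable def bhatt {N : ℕ} (P : (Fin N → Bool) → ℝ) (i : Fin N) : ℝ :=
  2 * ∑ u : Fin i.val → Bool,
      bMargin P i u * Real.sqrt (bCond P i u false * bCond P i u true)

lemma aux_H {ι : Type*} [Fintype ι] (m a b : ι → ℝ) (hm : ∀ u, 0 ≤ m u) (hs : ∑ u, m u = 1)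
    (ha : ∀ u, 0 ≤ a u) (hb : ∀ u, 0 ≤ b u) (hab : ∀ u, 0 < m u → a u + b u = 1)
    (δ : ℝ) (hδ0 : 0 ≤ δ) (hδ1 : δ ≤ 1)
    (hZ : 1 - δ ≤ 2 * ∑ u, m u * Real.sqrt (a u * b u)) :
    ∑ u, m u * (|a u - 1 / 2| + |b u - 1 / 2|) ≤ 2 * Real.sqrt (Real.log 2 * δ) := by
  have h1 := Real.pow_arith_mean_le_arith_mean_pow_of_even Finset.univ m
    (fun u => |a u - 1 / 2| + |b u - 1 / 2|) (fun i _ => hm i) hs (n := 2) (by norm_num)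
  have h2 := Real.pow_arith_mean_le_arith_mean_pow_of_even Finset.univ m
    (fun u => 2 * Real.sqrt (a u * b u)) (fun i _ => hm i) hs (n := 2) (by norm_num)
  have h3 : ∑ u, m u * (|a u - 1 / 2| + |b u - 1 / 2|) ^ 2
      + ∑ u, m u * (2 * Real.sqrt (a u * b u)) ^ 2 = 1 := by
    rw [← Finset.sum_add_distrib]
    refine Eq.trans ?_ hs
    refine Finset.sum_congr rfl fun u _ => ?_
    rcases (hm u).eq_or_lt with h | h
    · simp [← h]
    · have e : b u = 1 - a u := by linarith [hab u h]
      have e2 : |b u - 1 / 2| = |a u - 1 / 2| := by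
        rw [e, ← abs_neg]; congr 1; ring
      rw [e2, mul_pow, Real.sq_sqrt (mul_nonneg (ha u) (hb u)), ← two_mul, mul_pow, sq_abs, e]
      ring
  have h4 : 2 * ∑ u, m u * Real.sqrt (a u * b u) = ∑ u, m u * (2 * Real.sqrt (a u * b u)) := by
    rw [Finset.mul_sum]
    exact Finset.sum_congr rfl fun u _ => by ring
  rw [h4] at hZ
  have hl := Real.log_two_gt_d9
  have h5 : (1 - δ) ^ 2 ≤ (∑ u, m u * (2 * Real.sqrt (a u * b u))) ^ 2 := by
    have : 0 ≤ 1 - δ := by linarith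
    gcongr
  refine abs_le_of_sq_le_sq' ?_ (by positivity) |>.2
  rw [mul_pow, Real.sq_sqrt (by positivity)]
  nlinarith

lemma aux_L {ι : Type*} [Fintype ι] (m a b qa qb : ι → ℝ) (hm : ∀ u, 0 ≤ m u)
    (ha : ∀ u, 0 ≤ a u) (hb : ∀ u, 0 ≤ b u) (hab : ∀ u, 0 < m u → a u + b u = 1)
    (δ : ℝ) (hδ0 : 0 ≤ δ) (hδ1 : δ ≤ 1)
    (hZ : 2 * ∑ u, m u * Real.sqrt (a u * b u) ≤ δ)
    (hq : ∀ u, 0 < m u → (b u ≤ a u ∧ qa u = 1 ∧ qb u = 0) ∨ (a u ≤ b u ∧ qb u = 1 ∧ qa u = 0)) :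
    ∑ u, m u * (|a u - qa u| + |b u - qb u|) ≤ 2 * Real.sqrt (Real.log 2 * δ) := by
  have hl := Real.log_two_gt_d9
  have h1 : ∑ u, m u * (|a u - qa u| + |b u - qb u|) ≤ 2 * ∑ u, m u * Real.sqrt (a u * b u) := by
    rw [Finset.mul_sum]
    refine Finset.sum_le_sum fun u _ => ?_
    rcases (hm u).eq_or_lt with h | h
    · simp [← h]
    · have hab' := hab u h
      have ha' := ha u
      have hb' := hb u
      have : |a u - qa u| + |b u - qb u| ≤ 2 * Real.sqrt (a u * b u) := by
        rcases hq u h with ⟨h1, h2, h3⟩ | ⟨h1, h2, h3⟩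
        · have : b u ≤ Real.sqrt (a u * b u) := Real.le_sqrt_of_sq_le (by nlinarith)
          rw [h2, h3, abs_of_nonpos (by linarith), abs_of_nonneg (by linarith)]
          linarith
        · have : a u ≤ Real.sqrt (a u * b u) := Real.le_sqrt_of_sq_le (by nlinarith)
          rw [h2, h3, abs_of_nonneg (by linarith), abs_of_nonpos (by linarith)]
          linarith
      calc _ ≤ m u * (2 * Real.sqrt (a u * b u)) := by gcongr
        _ = _ := by ring
  have h2 : δ / 2 ≤ Real.sqrt (Real.log 2 * δ) := Real.le_sqrt_of_sq_le (by nlinarith)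
  linarith

lemma aux_step (p r c t : ℝ) (hp : 0 ≤ p) (ht : 0 ≤ t) :
    |p * c - r * t| ≤ |p - r| * t + p * |c - t| := by
  have h1 : |(p - r) * t| = |p - r| * t := by rw [abs_mul, abs_of_nonneg ht]
  have h2 : |p * (c - t)| = p * |c - t| := by rw [abs_mul, abs_of_nonneg hp]
  rw [← h1, ← h2]
  refine le_trans (le_of_eq ?_) (abs_add_le _ _)
  congr 1
  ring

/-- prefix marginal -/
noncomputable def pm {N : ℕ} (P : (Fin N → Bool) → ℝ) (k : ℕ) (hk : k ≤ N)
    (v : Fin k → Bool) : ℝ :=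
  ∑ x ∈ Finset.univ.filter
      (fun x : Fin N → Bool => ∀ j : Fin k, x (Fin.castLE hk j) = v j), P x

/-- prefix product -/
noncomputable def qm {N : ℕ} (q : ∀ i : Fin N, (Fin i.val → Bool) → Bool → ℝ) (k : ℕ) (hk : k ≤ N)
    (v : Fin k → Bool) : ℝ :=
  ∏ j : Fin k, q (Fin.castLE hk j) (fun l => v (Fin.castLE j.isLt.le l)) (v j)

lemma pm_snoc {N : ℕ} (P : (Fin N → Bool) → ℝ) (k : ℕ) (hk : k < N) (v : Fin k → Bool) (b : Bool) :
    pm P (k + 1) hk (Fin.snoc (α := fun _ => Bool) v b) = bMarginWith P ⟨k, hk⟩ v b := by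
  unfold pm bMarginWith
  refine Finset.sum_congr ?_ fun _ _ => rfl
  ext x
  simp only [Finset.mem_filter, Finset.mem_univ, true_and]
  rw [Fin.forall_fin_succ']
  simp only [Fin.snoc_castSucc, Fin.snoc_last]
  rfl

lemma qm_snoc {N : ℕ} (q : ∀ i : Fin N, (Fin i.val → Bool) → Bool → ℝ) (k : ℕ) (hk : k < N)
    (v : Fin k → Bool) (b : Bool) :
    qm q (k + 1) hk (Fin.snoc (α := fun _ => Bool) v b) = qm q k hk.le v * q ⟨k, hk⟩ v b := by
  unfold qm
  rw [Fin.prod_univ_castSucc]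
  have e : ∀ l : Fin k, (Fin.snoc (α := fun _ => Bool) v b : Fin (k + 1) → Bool) l.castSucc = v l :=
    fun l => Fin.snoc_castSucc (α := fun _ => Bool) b v l
  congr 1
  · refine Finset.prod_congr rfl fun j _ => ?_
    rw [e]
    have : (fun l : Fin j.val => (Fin.snoc (α := fun _ => Bool) v b : Fin (k + 1) → Bool)
      (Fin.castLE j.castSucc.isLt.le l)) = fun l => v (Fin.castLE j.isLt.le l) :=
      funext fun l => e (Fin.castLE j.isLt.le l)
    exact congrArg (fun w => q (Fin.castLE hk.le j) w (v j)) this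
  · rw [Fin.snoc_last]
    exact congrArg (fun w => q ⟨k, hk⟩ w b) (funext fun l => e l)

lemma bMarginWith_add {N : ℕ} (P : (Fin N → Bool) → ℝ) (i : Fin N) (u : Fin i.val → Bool) :
    bMarginWith P i u true + bMarginWith P i u false = bMargin P i u := by
  unfold bMarginWith bMargin
  simp only [← Finset.filter_filter]
  rw [← Finset.sum_filter_add_sum_filter_not (Finset.univ.filter
      (fun x : Fin N → Bool => ∀ j : Fin i.val, x (Fin.castLE i.isLt.le j) = u j))
      (fun x => x i = true)]
  simp only [Bool.not_eq_true]

lemma bMargin_sum {N : ℕ} (P : (Fin N → Bool) → ℝ) (i : Fin N) :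
    ∑ u, bMargin P i u = ∑ x, P x := by
  unfold bMargin
  rw [← Finset.sum_fiberwise Finset.univ
    (fun (x : Fin N → Bool) (j : Fin i.val) => x (Fin.castLE i.isLt.le j)) P]
  simp only [funext_iff]

lemma sum_snoc (k : ℕ) (f : (Fin (k + 1) → Bool) → ℝ) :
    ∑ w, f w = ∑ v : Fin k → Bool, (f (Fin.snoc (α := fun _ => Bool) v true)
      + f (Fin.snoc (α := fun _ => Bool) v false)) := by
  rw [← (Fin.snocEquiv (fun _ : Fin (k + 1) => Bool)).sum_comp, Fintype.sum_prod_type_right]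
  refine Finset.sum_congr rfl fun v _ => ?_
  rw [Fintype.sum_bool]
  rfl

/-- Finite single-layer form of Lemma 3 of the paper: the polar encoding
distribution `Q`, which puts uniform bits on the almost completely noisy
bit-channels `𝓗` (`Z_i ≥ 1−δ`), encodes the almost noiseless bit-channels `𝓛`
(`Z_i ≤ δ`) by the argmax decision rule (ties broken arbitrarily), and samples
the not-completely-polarized bit-channels `𝓡` from the true conditionals of
`P`, satisfies `∑_{u^{1:N}} |P(u^{1:N}) − Q(u^{1:N})| ≤ 2·N·sqrt(ln 2·δ)`. -/
theorem single_layer_polar_encoder_close (N : ℕ) (hN : 1 ≤ N)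
    (P : (Fin N → Bool) → ℝ) (hP0 : ∀ x, 0 ≤ P x) (hP1 : ∑ x, P x = 1)
    (δ : ℝ) (hδ0 : 0 ≤ δ) (hδ1 : δ ≤ 1)
    (𝓗 𝓛 𝓡 : Finset (Fin N))
    (hHL : Disjoint 𝓗 𝓛) (hHR : Disjoint 𝓗 𝓡) (hLR : Disjoint 𝓛 𝓡)
    (hcover : 𝓗 ∪ 𝓛 ∪ 𝓡 = Finset.univ)
    (hZH : ∀ i ∈ 𝓗, 1 - δ ≤ bhatt P i)
    (hZL : ∀ i ∈ 𝓛, bhatt P i ≤ δ)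
    (q : ∀ i : Fin N, (Fin i.val → Bool) → Bool → ℝ)
    (hqH : ∀ i ∈ 𝓗, ∀ u b, q i u b = 1 / 2)
    (hqL : ∀ i ∈ 𝓛, ∀ u, 0 < bMargin P i u →
      ∃ b : Bool, (∀ b', bCond P i u b' ≤ bCond P i u b) ∧
        q i u b = 1 ∧ q i u (!b) = 0)
    (hqR : ∀ i ∈ 𝓡, ∀ u, 0 < bMargin P i u → ∀ b, q i u b = bCond P i u b)
    (hqZero : ∀ i : Fin N, i ∉ 𝓗 → ∀ u, bMargin P i u = 0 → ∀ b, q i u b = 1 / 2) :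
    ∑ x : Fin N → Bool,
        |P x - ∏ i : Fin N, q i (fun j => x (Fin.castLE i.isLt.le j)) (x i)| ≤
      2 * N * Real.sqrt (Real.log 2 * δ) := by
  have hM0 : ∀ (i : Fin N) u, 0 ≤ bMargin P i u := fun i u => Finset.sum_nonneg fun x _ => hP0 x
  have hW0 : ∀ (i : Fin N) u b, 0 ≤ bMarginWith P i u b :=
    fun i u b => Finset.sum_nonneg fun x _ => hP0 x
  have hC0 : ∀ (i : Fin N) u b, 0 ≤ bCond P i u b := fun i u b => div_nonneg (hW0 i u b) (hM0 i u)
  have hMs : ∀ i : Fin N, ∑ u, bMargin P i u = 1 := fun i => (bMargin_sum P i).trans hP1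
  have hCs : ∀ (i : Fin N) u, 0 < bMargin P i u → bCond P i u true + bCond P i u false = 1 := by
    intro i u h
    unfold bCond
    rw [← add_div, bMarginWith_add, div_self h.ne']
  have hMC : ∀ (i : Fin N) u b, bMarginWith P i u b = bMargin P i u * bCond P i u b := by
    intro i u b
    unfold bCond
    rcases (hM0 i u).eq_or_lt with h | h
    · have := bMarginWith_add P i u
      have h1 := hW0 i u true
      have h2 := hW0 i u false
      rw [← h]
      cases b <;> linarith
    · field_simp
  have hmem : ∀ i : Fin N, i ∈ 𝓗 ∨ i ∈ 𝓛 ∨ i ∈ 𝓡 := by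
    intro i
    have : i ∈ 𝓗 ∪ 𝓛 ∪ 𝓡 := hcover ▸ Finset.mem_univ i
    simpa [or_assoc] using this
  have hq : ∀ (i : Fin N) u, (∀ b, 0 ≤ q i u b) ∧ q i u true + q i u false = 1 := by
    intro i u
    by_cases hH : i ∈ 𝓗
    · simp only [hqH i hH]; norm_num
    rcases (hM0 i u).eq_or_lt with h | h
    · simp only [hqZero i hH u h.symm]; norm_num
    rcases (hmem i).resolve_left hH with hL | hR
    · obtain ⟨b, -, h1, h2⟩ := hqL i hL u h
      cases b <;> simp at h1 h2 <;> simp [h1, h2]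
    · simp only [hqR i hR u h]
      exact ⟨hC0 i u, hCs i u h⟩
  have hE : ∀ i : Fin N, ∑ u, bMargin P i u * (|bCond P i u true - q i u true|
      + |bCond P i u false - q i u false|) ≤ 2 * Real.sqrt (Real.log 2 * δ) := by
    intro i
    have hb : bhatt P i = 2 * ∑ u : Fin i.val → Bool,
        bMargin P i u * Real.sqrt (bCond P i u true * bCond P i u false) := by
      unfold bhatt
      simp only [mul_comm (bCond P i _ false)]
    rcases hmem i with h | h | h
    · simp only [hqH i h]
      exact aux_H _ _ _ (hM0 i) (hMs i) (fun u => hC0 i u _) (fun u => hC0 i u _) (hCs i) δ hδ0 hδ1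
        (hb ▸ hZH i h)
    · refine aux_L _ _ _ _ _ (hM0 i) (fun u => hC0 i u _) (fun u => hC0 i u _) (hCs i) δ hδ0 hδ1
        (hb ▸ hZL i h) ?_
      intro u hu
      obtain ⟨b, h0, h1, h2⟩ := hqL i h u hu
      cases b
      · exact Or.inr ⟨h0 _, h1, h2⟩
      · exact Or.inl ⟨h0 _, h1, h2⟩
    · refine le_trans (le_of_eq ?_) (by positivity : (0 : ℝ) ≤ _)
      refine Finset.sum_eq_zero fun u _ => ?_
      rcases (hM0 i u).eq_or_lt with hu | hu
      · simp [← hu]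
      · simp [hqR i h u hu]
  have key : ∀ k (hk : k ≤ N), ∑ v, |pm P k hk v - qm q k hk v|
      ≤ 2 * k * Real.sqrt (Real.log 2 * δ) := by
    intro k
    induction k with
    | zero =>
      intro hk
      simp [pm, qm, hP1]
    | succ k ih =>
      intro hk
      have hk' : k < N := hk
      have ih' := ih hk'.le
      have hEk := hE ⟨k, hk'⟩
      rw [sum_snoc]
      have : ∀ v : Fin k → Bool,
          |pm P (k + 1) hk (Fin.snoc (α := fun _ => Bool) v true)
            - qm q (k + 1) hk (Fin.snoc (α := fun _ => Bool) v true)|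
          + |pm P (k + 1) hk (Fin.snoc (α := fun _ => Bool) v false)
            - qm q (k + 1) hk (Fin.snoc (α := fun _ => Bool) v false)|
          ≤ |pm P k hk'.le v - qm q k hk'.le v|
            + bMargin P ⟨k, hk'⟩ v * (|bCond P ⟨k, hk'⟩ v true - q ⟨k, hk'⟩ v true|
              + |bCond P ⟨k, hk'⟩ v false - q ⟨k, hk'⟩ v false|) := by
        intro v
        obtain ⟨hq0, hqs⟩ := hq ⟨k, hk'⟩ v
        have step : ∀ b, |pm P (k + 1) hk (Fin.snoc (α := fun _ => Bool) v b)
            - qm q (k + 1) hk (Fin.snoc (α := fun _ => Bool) v b)|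
            ≤ |pm P k hk'.le v - qm q k hk'.le v| * q ⟨k, hk'⟩ v b
              + bMargin P ⟨k, hk'⟩ v * |bCond P ⟨k, hk'⟩ v b - q ⟨k, hk'⟩ v b| := by
          intro b
          rw [pm_snoc P k hk' v b, qm_snoc q k hk' v b, hMC]
          have e1 : bMargin P ⟨k, hk'⟩ v = pm P k hk'.le v := rfl
          rw [e1]
          exact aux_step _ _ _ _ (hM0 ⟨k, hk'⟩ v) (hq0 b)
        have s1 := step true
        have s2 := step false
        have e : q ⟨k, hk'⟩ v true = 1 - q ⟨k, hk'⟩ v false := by linarith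
        have e3 : |pm P k hk'.le v - qm q k hk'.le v| * q ⟨k, hk'⟩ v true
          + |pm P k hk'.le v - qm q k hk'.le v| * q ⟨k, hk'⟩ v false
          = |pm P k hk'.le v - qm q k hk'.le v| := by rw [← mul_add, hqs, mul_one]
        linarith
      refine (Finset.sum_le_sum fun v _ => this v).trans ?_
      rw [Finset.sum_add_distrib]
      push_cast
      refine (add_le_add ih' hEk).trans (le_of_eq ?_)
      ring
  have hfin := key N le_rfl
  refine le_trans (le_of_eq ?_) hfin
  refine Finset.sum_congr rfl fun x _ => ?_
  have e1 : pm P N le_rfl x = P x := by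
    unfold pm
    have : (Finset.univ.filter
      (fun y : Fin N → Bool => ∀ j : Fin N, y (Fin.castLE le_rfl j) = x j)) = {x} := by
      ext y
      simp [funext_iff]
    rw [this, Finset.sum_singleton]
  rw [e1]
  rfl
end

section
/- Let N ≥ 1 and let P be a probability mass function on {0,1}^N × {0,1}^N × {0,1}^N, written P(u_w, u_v, u_x) = P₁(u_w)·P₂(u_v | u_w)·P₃(u_x | u_v), where P₃ depends on u_v only (three-layer Markov structure). For the first layer define, for each i, the Bhattacharyya parameter Z_i^w of the i-th bit of u_w given its prefix under P₁; for the second layer define Z_i^v of the i-th bit of u_v given (u_w, prefix of u_v) under P₁·P₂; for the third layer define Z_i^x of the i-th bit of u_x given (u_v, prefix of u_x) under the marginal of (u_v, u_x); in each case Z = 2·Σ_{conditioning values} (probability of conditioning value)·sqrt( (conditional probability of bit 0)·(conditional probability of bit 1) ). Let δ ∈ [0,1] and suppose that for each layer ℓ ∈ {w,v,x} the index set {1,…,N} is partitioned into 𝓗^ℓ, 𝓛^ℓ, 𝓡^ℓ with Z_i^ℓ ≥ 1−δ on 𝓗^ℓ and Z_i^ℓ ≤ δ on 𝓛^ℓ.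 Define Q(u_w,u_v,u_x) = Q₁(u_w)·Q₂(u_v|u_w)·Q₃(u_x|u_v) where each layer's conditional kernels are: uniform on {0,1} for indices in 𝓗^ℓ; the point mass at a maximizer of the corresponding conditional of P for indices in 𝓛^ℓ (defined whenever the conditioning event has positive P-probability, uniform otherwise); and equal to the corresponding conditional of P for indices in 𝓡^ℓ (uniform when undefined). Then Σ_{u_w,u_v,u_x} |P(u_w,u_v,u_x) − Q(u_w,u_v,u_x)| ≤ 6·N·sqrt( ln 2 · δ ). -/
open scoped BigOperators

/-- Joint probability `W(C = c, u^{1:i-1} = u)` of a side-information value `c`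
together with a prefix `u` of length `i` of a `{0,1}^N`-valued variable, under a
joint weight `W : C → {0,1}^N → ℝ`. -/
noncomputable def cMargin {N : ℕ} {C : Type*} [Fintype C]
    (W : C → (Fin N → Bool) → ℝ) (i : Fin N) (c : C) (u : Fin i.val → Bool) : ℝ :=
  ∑ v ∈ Finset.univ.filter
      (fun v : Fin N → Bool => ∀ j : Fin i.val, v (Fin.castLE i.isLt.le j) = u j), W c v

/-- Joint probability `W(C = c, u^{1:i-1} = u, u_i = b)`. -/
noncomputable def cMarginWith {N : ℕ} {C : Type*} [Fintype C]
    (W : C → (Fin N → Bool) → ℝ) (i : Fin N) (c : C) (u : Fin i.val → Bool)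
    (b : Bool) : ℝ :=
  ∑ v ∈ Finset.univ.filter
      (fun v : Fin N → Bool =>
        (∀ j : Fin i.val, v (Fin.castLE i.isLt.le j) = u j) ∧ v i = b), W c v

/-- Conditional probability of the `i`-th bit being `b` given side information
`c` and prefix `u` (junk value `0` when the conditioning event has zero
probability, by real division-by-zero conventions). -/
noncomputable def cCond {N : ℕ} {C : Type*} [Fintype C]
    (W : C → (Fin N → Bool) → ℝ) (i : Fin N) (c : C) (u : Fin i.val → Bool)
    (b : Bool) : ℝ :=
  cMarginWith W i c u b / cMargin W i c u

/-- Conditional Bhattacharyya parameter of the `i`-th bit given the side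
information and the prefix:
`Z_i = 2·∑_{c,u} W(c, u)·sqrt(p_i(0|c,u)·p_i(1|c,u))`. -/
noncomputable def cBhatt {N : ℕ} {C : Type*} [Fintype C]
    (W : C → (Fin N → Bool) → ℝ) (i : Fin N) : ℝ :=
  2 * ∑ c : C, ∑ u : Fin i.val → Bool,
      cMargin W i c u * Real.sqrt (cCond W i c u false * cCond W i c u true)

/-- `(𝓗, 𝓛, 𝓡)` is a partition of the index set `{1,…,N}`. -/
def IsTripartition {N : ℕ} (𝓗 𝓛 𝓡 : Finset (Fin N)) : Prop :=
  Disjoint 𝓗 𝓛 ∧ Disjoint 𝓗 𝓡 ∧ Disjoint 𝓛 𝓡 ∧ 𝓗 ∪ 𝓛 ∪ 𝓡 = Finset.univ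

/-- The conditional kernels `q i c u b` of one layer of the polar encoder, for
the true joint weight `W`: uniform bits on the indices in `𝓗`, the argmax
decision rule (point mass at a maximizer of the conditional of `W`, ties broken
arbitrarily) on the indices in `𝓛`, the true conditional of `W` on the indices
in `𝓡`, and uniform whenever the conditioning event has zero probability. -/
def IsPolarEncoderKernel {N : ℕ} {C : Type*} [Fintype C]
    (W : C → (Fin N → Bool) → ℝ) (𝓗 𝓛 𝓡 : Finset (Fin N))
    (q : ∀ i : Fin N, C → (Fin i.val → Bool) → Bool → ℝ) : Prop :=
  (∀ i ∈ 𝓗, ∀ c u b, q i c u b = 1 / 2) ∧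
  (∀ i ∈ 𝓛, ∀ c u, 0 < cMargin W i c u →
    ∃ b : Bool, (∀ b', cCond W i c u b' ≤ cCond W i c u b) ∧
      q i c u b = 1 ∧ q i c u (!b) = 0) ∧
  (∀ i ∈ 𝓡, ∀ c u, 0 < cMargin W i c u → ∀ b, q i c u b = cCond W i c u b) ∧
  (∀ i : Fin N, i ∉ 𝓗 → ∀ c u, cMargin W i c u = 0 → ∀ b, q i c u b = 1 / 2)

section PolarHelpers
open Finset

lemma sum_snoc_aux {N : ℕ} (f : (Fin (N+1) → Bool) → ℝ) :
    ∑ v, f v = ∑ u : Fin N → Bool, ∑ b : Bool, f (Fin.snoc (α := fun _ => Bool) u b) := by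
  rw [← Equiv.sum_comp (Fin.snocEquiv (fun _ : Fin (N+1) => Bool)), Fintype.sum_prod_type,
    Finset.sum_comm]
  rfl

lemma snoc_castLE_aux {N k : ℕ} (h : k ≤ N) (h' : k ≤ N + 1) (u : Fin N → Bool) (b : Bool)
    (j : Fin k) :
    Fin.snoc (α := fun _ => Bool) u b (Fin.castLE h' j) = u (Fin.castLE h j) := by
  have : Fin.castLE h' j = Fin.castSucc (Fin.castLE h j) := by ext; simp
  rw [this, Fin.snoc_castSucc]

lemma cMargin_castSucc_aux {N : ℕ} {C : Type*} [Fintype C]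
    (W : C → (Fin (N+1) → Bool) → ℝ) (i : Fin N) (c : C) (u : Fin i.val → Bool) :
    cMargin W i.castSucc c u =
      cMargin (fun c v => ∑ b, W c (Fin.snoc (α := fun _ => Bool) v b)) i c u := by
  unfold cMargin
  rw [Finset.sum_filter, Finset.sum_filter, sum_snoc_aux]
  refine Finset.sum_congr rfl fun v _ => ?_
  have : ∀ b, (∀ j : Fin i.castSucc.val, Fin.snoc (α := fun _ => Bool) v b
      (Fin.castLE i.castSucc.isLt.le j) = u j) ↔
      ∀ j : Fin i.val, v (Fin.castLE i.isLt.le j) = u j := by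
    intro b
    refine forall_congr' fun j => ?_
    rw [snoc_castLE_aux i.isLt.le]
  simp only [this]
  split_ifs <;> simp

lemma cMarginWith_castSucc_aux {N : ℕ} {C : Type*} [Fintype C]
    (W : C → (Fin (N+1) → Bool) → ℝ) (i : Fin N) (c : C) (u : Fin i.val → Bool) (a : Bool) :
    cMarginWith W i.castSucc c u a =
      cMarginWith (fun c v => ∑ b, W c (Fin.snoc (α := fun _ => Bool) v b)) i c u a := by
  unfold cMarginWith
  rw [Finset.sum_filter, Finset.sum_filter, sum_snoc_aux]
  refine Finset.sum_congr rfl fun v _ => ?_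
  have : ∀ b, (∀ j : Fin i.castSucc.val, Fin.snoc (α := fun _ => Bool) v b
      (Fin.castLE i.castSucc.isLt.le j) = u j) ↔
      ∀ j : Fin i.val, v (Fin.castLE i.isLt.le j) = u j := by
    intro b
    refine forall_congr' fun j => ?_
    rw [snoc_castLE_aux i.isLt.le]
  simp only [this, Fin.snoc_castSucc]
  split_ifs <;> simp

lemma cMargin_last_aux {N : ℕ} {C : Type*} [Fintype C]
    (W : C → (Fin (N+1) → Bool) → ℝ) (c : C) (u : Fin N → Bool) :
    cMargin W (Fin.last N) c u = ∑ b, W c (Fin.snoc (α := fun _ => Bool) u b) := by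
  unfold cMargin
  rw [Finset.sum_filter, sum_snoc_aux]
  have : ∀ (v : Fin N → Bool) b, (∀ j : Fin (Fin.last N).val, Fin.snoc (α := fun _ => Bool) v b
      (Fin.castLE (Fin.last N).isLt.le j) = u j) ↔ v = u := by
    intro v b
    rw [funext_iff]
    refine forall_congr' fun j => ?_
    rw [snoc_castLE_aux le_rfl]; rfl
  simp only [this]
  rw [Finset.sum_eq_single u]
  · simp
  · intro v _ hv; simp [hv]
  · simp

lemma cMarginWith_last_aux {N : ℕ} {C : Type*} [Fintype C]
    (W : C → (Fin (N+1) → Bool) → ℝ) (c : C) (u : Fin N → Bool) (a : Bool) :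
    cMarginWith W (Fin.last N) c u a = W c (Fin.snoc (α := fun _ => Bool) u a) := by
  unfold cMarginWith
  rw [Finset.sum_filter, sum_snoc_aux]
  have : ∀ (v : Fin N → Bool) b, (∀ j : Fin (Fin.last N).val, Fin.snoc (α := fun _ => Bool) v b
      (Fin.castLE (Fin.last N).isLt.le j) = u j) ↔ v = u := by
    intro v b
    rw [funext_iff]
    refine forall_congr' fun j => ?_
    rw [snoc_castLE_aux le_rfl]; rfl
  simp only [this, Fin.snoc_last]
  rw [Finset.sum_eq_single u]
  · simp
  · intro v _ hv; simp [hv]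
  · simp

/-- The product of the kernels along a word. -/
noncomputable def kprod {N : ℕ} {C : Type*}
    (q : ∀ i : Fin N, C → (Fin i.val → Bool) → Bool → ℝ) (c : C) (v : Fin N → Bool) : ℝ :=
  ∏ i : Fin N, q i c (fun j => v (Fin.castLE i.isLt.le j)) (v i)

lemma kprod_snoc {N : ℕ} {C : Type*}
    (q : ∀ i : Fin (N+1), C → (Fin i.val → Bool) → Bool → ℝ) (c : C) (v : Fin N → Bool)
    (b : Bool) :
    kprod q c (Fin.snoc (α := fun _ => Bool) v b) =
      kprod (fun i : Fin N => q i.castSucc) c v * q (Fin.last N) c v b := by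
  unfold kprod
  rw [Fin.prod_univ_castSucc]
  congr 1
  · refine Finset.prod_congr rfl fun i _ => ?_
    rw [Fin.snoc_castSucc]
    congr 1
    funext j
    exact snoc_castLE_aux i.isLt.le _ v b j
  · rw [Fin.snoc_last]
    congr 1
    funext j
    exact snoc_castLE_aux le_rfl _ v b j

lemma kprod_nonneg {N : ℕ} {C : Type*}
    (q : ∀ i : Fin N, C → (Fin i.val → Bool) → Bool → ℝ)
    (h : ∀ i c u b, 0 ≤ q i c u b) (c : C) (v : Fin N → Bool) : 0 ≤ kprod q c v :=
  Finset.prod_nonneg fun _ _ => h _ _ _ _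

lemma kprod_sum {N : ℕ} {C : Type*}
    (q : ∀ i : Fin N, C → (Fin i.val → Bool) → Bool → ℝ)
    (h : ∀ i c u, ∑ b, q i c u b = 1) (c : C) : ∑ v, kprod q c v = 1 := by
  induction N with
  | zero => simp [kprod]
  | succ N ih =>
    rw [sum_snoc_aux]
    simp only [kprod_snoc, ← Finset.mul_sum]
    have : ∀ u : Fin N → Bool, ∑ b, q (Fin.last N) c u b = 1 := fun u => h (Fin.last N) c u
    simp only [this, mul_one]
    exact ih _ (fun i c u => h i.castSucc c u)

lemma layer_telescope {N : ℕ} {C : Type*} [Fintype C]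
    (W : C → (Fin N → Bool) → ℝ)
    (q : ∀ i : Fin N, C → (Fin i.val → Bool) → Bool → ℝ)
    (h0 : ∀ i c u b, 0 ≤ q i c u b) (h1 : ∀ i c u, ∑ b, q i c u b = 1) :
    ∑ c, ∑ v, |W c v - (∑ v', W c v') * kprod q c v| ≤
      ∑ i : Fin N, ∑ c, ∑ u : Fin i.val → Bool, ∑ b,
        |cMarginWith W i c u b - cMargin W i c u * q i c u b| := by
  induction N with
  | zero => simp [kprod]
  | succ N ih =>
    have IH := ih (fun c v => ∑ b, W c (Fin.snoc (α := fun _ => Bool) v b))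
      (fun i => q i.castSucc) (fun i => h0 i.castSucc) (fun i => h1 i.castSucc)
    rw [Fin.sum_univ_castSucc]
    simp only [cMargin_castSucc_aux, cMarginWith_castSucc_aux]
    have hl : ∑ c, ∑ u : Fin (Fin.last N).val → Bool, ∑ b,
        |cMarginWith W (Fin.last N) c u b - cMargin W (Fin.last N) c u * q (Fin.last N) c u b|
        = ∑ c, ∑ u : Fin N → Bool, ∑ b, |W c (Fin.snoc (α := fun _ => Bool) u b) -
          (∑ b, W c (Fin.snoc (α := fun _ => Bool) u b)) * q (Fin.last N) c u b| := by
      refine Finset.sum_congr rfl fun c _ => ?_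
      refine Finset.sum_congr rfl fun u _ => ?_
      refine Finset.sum_congr rfl fun b _ => ?_
      rw [← cMargin_last_aux W c u, ← cMarginWith_last_aux W c u b]
    rw [hl]
    refine le_trans ?_ (add_le_add IH le_rfl)
    rw [← Finset.sum_add_distrib]
    refine Finset.sum_le_sum fun c _ => ?_
    rw [sum_snoc_aux, ← Finset.sum_add_distrib]
    refine Finset.sum_le_sum fun u _ => ?_
    have hM : ∑ v', W c v' = ∑ v' : Fin N → Bool, ∑ b, W c (Fin.snoc (α := fun _ => Bool) v' b) :=
      sum_snoc_aux _
    rw [hM]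
    set M := ∑ v' : Fin N → Bool, ∑ b, W c (Fin.snoc (α := fun _ => Bool) v' b)
    set S := ∑ b, W c (Fin.snoc (α := fun _ => Bool) u b)
    set K := kprod (fun i : Fin N => q i.castSucc) c u with hK
    have hq1 : ∑ b, q (Fin.last N) c u b = 1 := h1 (Fin.last N) c u
    calc ∑ b, |W c (Fin.snoc (α := fun _ => Bool) u b) -
            M * kprod q c (Fin.snoc (α := fun _ => Bool) u b)|
        ≤ ∑ b, (|S - M * K| * q (Fin.last N) c u b +
            |W c (Fin.snoc (α := fun _ => Bool) u b) - S * q (Fin.last N) c u b|) := by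
          refine Finset.sum_le_sum fun b _ => ?_
          rw [kprod_snoc, ← hK]
          have hq0 : 0 ≤ q (Fin.last N) c u b := h0 (Fin.last N) c u b
          rw [show |S - M * K| * q (Fin.last N) c u b = |(S - M * K) * q (Fin.last N) c u b| by
            rw [abs_mul, abs_of_nonneg hq0]]
          refine le_trans (le_of_eq ?_) (abs_add_le _ _)
          congr 1; ring
      _ = _ := by
          rw [Finset.sum_add_distrib, ← Finset.mul_sum, hq1, mul_one]

lemma cMargin_split {N : ℕ} {C : Type*} [Fintype C]
    (W : C → (Fin N → Bool) → ℝ) (i : Fin N) (c : C) (u : Fin i.val → Bool) :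
    cMargin W i c u = cMarginWith W i c u false + cMarginWith W i c u true := by
  unfold cMargin cMarginWith
  simp only [Finset.sum_filter]
  rw [← Finset.sum_add_distrib]
  refine Finset.sum_congr rfl fun v _ => ?_
  cases v i <;> simp

lemma cMargin_total {N : ℕ} {C : Type*} [Fintype C]
    (W : C → (Fin N → Bool) → ℝ) (i : Fin N) (c : C) :
    ∑ u, cMargin W i c u = ∑ v, W c v := by
  unfold cMargin
  simp only [Finset.sum_filter]
  rw [Finset.sum_comm]
  refine Finset.sum_congr rfl fun v _ => ?_
  rw [Finset.sum_eq_single (fun j : Fin i.val => v (Fin.castLE i.isLt.le j))]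
  · simp
  · intro u _ hu
    rw [if_neg]
    intro h; exact hu (funext fun j => (h j).symm)
  · simp

lemma cMarginWith_nonneg {N : ℕ} {C : Type*} [Fintype C]
    (W : C → (Fin N → Bool) → ℝ) (hW : ∀ c v, 0 ≤ W c v) (i : Fin N) (c : C)
    (u : Fin i.val → Bool) (b : Bool) : 0 ≤ cMarginWith W i c u b :=
  Finset.sum_nonneg fun _ _ => hW _ _

lemma cMargin_nonneg {N : ℕ} {C : Type*} [Fintype C]
    (W : C → (Fin N → Bool) → ℝ) (hW : ∀ c v, 0 ≤ W c v) (i : Fin N) (c : C)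
    (u : Fin i.val → Bool) : 0 ≤ cMargin W i c u :=
  Finset.sum_nonneg fun _ _ => hW _ _

lemma cCond_facts {N : ℕ} {C : Type*} [Fintype C]
    (W : C → (Fin N → Bool) → ℝ) (hW : ∀ c v, 0 ≤ W c v) (i : Fin N) (c : C)
    (u : Fin i.val → Bool) (hm : 0 < cMargin W i c u) :
    (∀ b, 0 ≤ cCond W i c u b) ∧ cCond W i c u false + cCond W i c u true = 1 ∧
      ∀ b, cMarginWith W i c u b = cMargin W i c u * cCond W i c u b := by
  refine ⟨fun b => div_nonneg (cMarginWith_nonneg W hW i c u b) hm.le, ?_, fun b => ?_⟩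
  · unfold cCond
    rw [← add_div, ← cMargin_split, div_self hm.ne']
  · unfold cCond; field_simp

lemma kernel_prob {N : ℕ} {C : Type*} [Fintype C]
    (W : C → (Fin N → Bool) → ℝ) (hW : ∀ c v, 0 ≤ W c v) (𝓗 𝓛 𝓡 : Finset (Fin N))
    (hp : IsTripartition 𝓗 𝓛 𝓡)
    (q : ∀ i : Fin N, C → (Fin i.val → Bool) → Bool → ℝ)
    (hq : IsPolarEncoderKernel W 𝓗 𝓛 𝓡 q) (i : Fin N) (c : C) (u : Fin i.val → Bool) :
    (∀ b, 0 ≤ q i c u b) ∧ ∑ b, q i c u b = 1 := by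
  obtain ⟨hH, hL, hR, hZ⟩ := hq
  have half : (∀ b, q i c u b = 1 / 2) → (∀ b, 0 ≤ q i c u b) ∧ ∑ b, q i c u b = 1 := by
    intro h
    simp [h]
  by_cases hiH : i ∈ 𝓗
  · exact half (hH i hiH c u)
  rcases (cMargin_nonneg W hW i c u).eq_or_lt with h0 | hpos
  · exact half (hZ i hiH c u h0.symm)
  have hmem : i ∈ 𝓗 ∪ 𝓛 ∪ 𝓡 := by rw [hp.2.2.2]; exact Finset.mem_univ i
  simp only [Finset.mem_union] at hmem
  rcases hmem with (h | h) | h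
  · exact absurd h hiH
  · obtain ⟨b, _, h1, h2⟩ := hL i h c u hpos
    cases b <;> simp at h1 h2 <;> simp [h1, h2]
  · have h := hR i h c u hpos
    obtain ⟨f0, f1, _⟩ := cCond_facts W hW i c u hpos
    simp only [h]
    refine ⟨f0, ?_⟩
    simp; linarith

lemma sqrt_const_aux (δ : ℝ) (hδ0 : 0 ≤ δ) (x : ℝ) (hx : x ^ 2 ≤ 2 * δ) :
    x ≤ 2 * Real.sqrt (Real.log 2 * δ) := by
  have hl := Real.log_two_gt_d9
  have : 2 * Real.sqrt (Real.log 2 * δ) = Real.sqrt (4 * (Real.log 2 * δ)) := by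
    rw [Real.sqrt_mul (by norm_num : (0:ℝ) ≤ 4), show (4:ℝ) = 2 ^ 2 by norm_num,
      Real.sqrt_sq (by norm_num)]
  rw [this]
  refine Real.le_sqrt_of_sq_le (hx.trans ?_)
  nlinarith

lemma index_bound {N : ℕ} {C : Type*} [Fintype C]
    (W : C → (Fin N → Bool) → ℝ) (hW : ∀ c v, 0 ≤ W c v) (hW1 : ∑ c, ∑ v, W c v = 1)
    (𝓗 𝓛 𝓡 : Finset (Fin N)) (hp : IsTripartition 𝓗 𝓛 𝓡)
    (δ : ℝ) (hδ0 : 0 ≤ δ) (hδ1 : δ ≤ 1)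
    (hZH : ∀ i ∈ 𝓗, 1 - δ ≤ cBhatt W i) (hZL : ∀ i ∈ 𝓛, cBhatt W i ≤ δ)
    (q : ∀ i : Fin N, C → (Fin i.val → Bool) → Bool → ℝ)
    (hq : IsPolarEncoderKernel W 𝓗 𝓛 𝓡 q) (i : Fin N) :
    ∑ c, ∑ u : Fin i.val → Bool, ∑ b,
        |cMarginWith W i c u b - cMargin W i c u * q i c u b| ≤
      2 * Real.sqrt (Real.log 2 * δ) := by
  obtain ⟨hH, hL, hR, hZ⟩ := hq
  have hzero : ∀ c u, cMargin W i c u = 0 → ∀ b, cMarginWith W i c u b = 0 := by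
    intro c u h b
    have hs := cMargin_split W i c u
    have h1 := cMarginWith_nonneg W hW i c u false
    have h2 := cMarginWith_nonneg W hW i c u true
    cases b <;> linarith
  have hmem : i ∈ 𝓗 ∪ 𝓛 ∪ 𝓡 := by rw [hp.2.2.2]; exact Finset.mem_univ i
  simp only [Finset.mem_union] at hmem
  rcases hmem with (h | h) | h
  · -- high entropy
    have hB := hZH i h
    have hm1 : ∑ p : C × (Fin i.val → Bool), cMargin W i p.1 p.2 = 1 := by
      rw [Fintype.sum_prod_type]
      simp only [cMargin_total, hW1]
    set t : C × (Fin i.val → Bool) → ℝ :=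
      fun p => |cCond W i p.1 p.2 false - cCond W i p.1 p.2 true| with ht
    have hJ := Real.pow_arith_mean_le_arith_mean_pow_of_even Finset.univ
      (fun p : C × (Fin i.val → Bool) => cMargin W i p.1 p.2) t
      (fun p _ => cMargin_nonneg W hW i p.1 p.2) hm1 (n := 2) even_two
    have hLHS : ∑ c, ∑ u : Fin i.val → Bool, ∑ b,
        |cMarginWith W i c u b - cMargin W i c u * q i c u b| =
        ∑ p : C × (Fin i.val → Bool), cMargin W i p.1 p.2 * t p := by
      rw [Fintype.sum_prod_type]
      refine Finset.sum_congr rfl fun c _ => Finset.sum_congr rfl fun u _ => ?_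
      simp only [hH i h, Fintype.sum_bool, ht]
      rcases (cMargin_nonneg W hW i c u).eq_or_lt with h0 | hpos
      · simp [← h0, hzero c u h0.symm]
      · obtain ⟨f0, f1, f2⟩ := cCond_facts W hW i c u hpos
        rw [f2, f2, ← mul_sub, ← mul_sub, abs_mul, abs_mul, abs_of_pos hpos, ← mul_add]
        congr 1
        have e1 : cCond W i c u true = 1 - cCond W i c u false := by linarith
        rw [e1, show (1 - cCond W i c u false - 1 / 2) = -(cCond W i c u false - 1/2) by ring,
          abs_neg, show cCond W i c u false - (1 - cCond W i c u false) =
            2 * (cCond W i c u false - 1/2) by ring, abs_mul, abs_two]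
        ring
    rw [hLHS]
    refine sqrt_const_aux δ hδ0 _ (hJ.trans ?_)
    have hpt : ∀ p : C × (Fin i.val → Bool), cMargin W i p.1 p.2 * t p ^ 2 ≤
        2 * cMargin W i p.1 p.2 - 4 * (cMargin W i p.1 p.2 *
          Real.sqrt (cCond W i p.1 p.2 false * cCond W i p.1 p.2 true)) := by
      rintro ⟨c, u⟩
      simp only [ht]
      rcases (cMargin_nonneg W hW i c u).eq_or_lt with h0 | hpos
      · simp [← h0]
      · obtain ⟨f0, f1, f2⟩ := cCond_facts W hW i c u hpos
        rw [sq_abs]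
        have hs := Real.sq_sqrt (mul_nonneg (f0 false) (f0 true))
        set s := Real.sqrt (cCond W i c u false * cCond W i c u true)
        have key : (cCond W i c u false - cCond W i c u true) ^ 2 ≤ 2 - 4 * s := by
          have : (cCond W i c u false - cCond W i c u true) ^ 2 = 1 - 4 * s ^ 2 := by
            rw [hs]
            have e1 : cCond W i c u true = 1 - cCond W i c u false := by linarith
            rw [e1]; ring
          nlinarith [sq_nonneg (2 * s - 1)]
        nlinarith
    refine (Finset.sum_le_sum fun p _ => hpt p).trans ?_
    rw [Finset.sum_sub_distrib, ← Finset.mul_sum, ← Finset.mul_sum, hm1]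
    unfold cBhatt at hB
    rw [Fintype.sum_prod_type]
    linarith
  · -- low entropy
    have hB := hZL i h
    refine sqrt_const_aux δ hδ0 _ ?_
    have hle : ∑ c, ∑ u : Fin i.val → Bool, ∑ b,
        |cMarginWith W i c u b - cMargin W i c u * q i c u b| ≤ cBhatt W i := by
      unfold cBhatt
      rw [Finset.mul_sum]
      refine Finset.sum_le_sum fun c _ => ?_
      rw [Finset.mul_sum]
      refine Finset.sum_le_sum fun u _ => ?_
      rcases (cMargin_nonneg W hW i c u).eq_or_lt with h0 | hpos
      · simp [← h0, hzero c u h0.symm]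
      · obtain ⟨f0, f1, f2⟩ := cCond_facts W hW i c u hpos
        obtain ⟨b, hb, hb1, hb2⟩ := hL i h c u hpos
        have g0 := f0 false
        have g1 := f0 true
        have hsq : ∀ x y : ℝ, 0 ≤ x → x ≤ y → x ≤ Real.sqrt (x * y) := fun x y hx hxy =>
          Real.le_sqrt_of_sq_le (by nlinarith)
        simp only [Fintype.sum_bool, f2, ← mul_sub, abs_mul, abs_of_pos hpos]
        rw [← mul_add, mul_left_comm]
        refine mul_le_mul_of_nonneg_left ?_ hpos.le
        cases b
        · have hx := hb true
          simp only [Bool.not_false] at hb2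
          rw [hb1, hb2, mul_comm (cCond W i c u false)]
          have := hsq _ _ g1 hx
          rw [abs_of_nonneg (by linarith), abs_of_nonpos (by linarith)]
          linarith
        · have hx := hb false
          simp only [Bool.not_true] at hb2
          rw [hb1, hb2]
          have := hsq _ _ g0 hx
          rw [abs_of_nonpos (by linarith), abs_of_nonneg (by linarith)]
          linarith
    have hnn : 0 ≤ ∑ c, ∑ u : Fin i.val → Bool, ∑ b,
        |cMarginWith W i c u b - cMargin W i c u * q i c u b| :=
      Finset.sum_nonneg fun _ _ => Finset.sum_nonneg fun _ _ => Finset.sum_nonneg fun _ _ =>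
        abs_nonneg _
    nlinarith
  · have : ∑ c, ∑ u : Fin i.val → Bool, ∑ b,
        |cMarginWith W i c u b - cMargin W i c u * q i c u b| = 0 := by
      refine Finset.sum_eq_zero fun c _ => Finset.sum_eq_zero fun u _ =>
        Finset.sum_eq_zero fun b _ => ?_
      rcases (cMargin_nonneg W hW i c u).eq_or_lt with h0 | hpos
      · simp [← h0, hzero c u h0.symm]
      · rw [hR i h c u hpos, (cCond_facts W hW i c u hpos).2.2, sub_self, abs_zero]
    rw [this]
    positivity

lemma layer_bound {N : ℕ} {C : Type*} [Fintype C]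
    (W : C → (Fin N → Bool) → ℝ) (hW : ∀ c v, 0 ≤ W c v) (hW1 : ∑ c, ∑ v, W c v = 1)
    (𝓗 𝓛 𝓡 : Finset (Fin N)) (hp : IsTripartition 𝓗 𝓛 𝓡)
    (δ : ℝ) (hδ0 : 0 ≤ δ) (hδ1 : δ ≤ 1)
    (hZH : ∀ i ∈ 𝓗, 1 - δ ≤ cBhatt W i) (hZL : ∀ i ∈ 𝓛, cBhatt W i ≤ δ)
    (q : ∀ i : Fin N, C → (Fin i.val → Bool) → Bool → ℝ)
    (hq : IsPolarEncoderKernel W 𝓗 𝓛 𝓡 q) :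
    ∑ c, ∑ v, |W c v - (∑ v', W c v') * kprod q c v| ≤
      N * (2 * Real.sqrt (Real.log 2 * δ)) := by
  have hk := kernel_prob W hW 𝓗 𝓛 𝓡 hp q hq
  refine (layer_telescope W q (fun i c u => (hk i c u).1) (fun i c u => (hk i c u).2)).trans ?_
  refine (Finset.sum_le_sum fun i _ =>
    index_bound W hW hW1 𝓗 𝓛 𝓡 hp δ hδ0 hδ1 hZH hZL q hq i).trans ?_
  simp

end PolarHelpers

/-- Finite quantitative form of Lemma 3 of the paper for the three-layer Markov
structure `P(u_w, u_v, u_x) = P₁(u_w)·P₂(u_v|u_w)·P₃(u_x|u_v)`: the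
distribution `Q = Q₁·Q₂·Q₃` induced by the three-layer polar encoder (uniform
bits on the high-Bhattacharyya bit-channels `𝓗`, the argmax rule on the
low-Bhattacharyya bit-channels `𝓛`, and the true conditionals on the
not-completely-polarized bit-channels `𝓡`, in each layer) satisfies
`∑_{u_w,u_v,u_x} |P(u_w,u_v,u_x) − Q(u_w,u_v,u_x)| ≤ 6·N·sqrt(ln 2·δ)`. -/
theorem three_layer_polar_encoder_close (N : ℕ) (hN : 1 ≤ N)
    (P1 : (Fin N → Bool) → ℝ)
    (P2 : (Fin N → Bool) → (Fin N → Bool) → ℝ)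
    (P3 : (Fin N → Bool) → (Fin N → Bool) → ℝ)
    (hP10 : ∀ uw, 0 ≤ P1 uw) (hP11 : ∑ uw, P1 uw = 1)
    (hP20 : ∀ uw uv, 0 ≤ P2 uw uv) (hP21 : ∀ uw, ∑ uv, P2 uw uv = 1)
    (hP30 : ∀ uv ux, 0 ≤ P3 uv ux) (hP31 : ∀ uv, ∑ ux, P3 uv ux = 1)
    (δ : ℝ) (hδ0 : 0 ≤ δ) (hδ1 : δ ≤ 1)
    (𝓗w 𝓛w 𝓡w 𝓗v 𝓛v 𝓡v 𝓗x 𝓛x 𝓡x : Finset (Fin N))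
    (hpw : IsTripartition 𝓗w 𝓛w 𝓡w)
    (hpv : IsTripartition 𝓗v 𝓛v 𝓡v)
    (hpx : IsTripartition 𝓗x 𝓛x 𝓡x)
    (hZwH : ∀ i ∈ 𝓗w, 1 - δ ≤ cBhatt (fun _ : Unit => P1) i)
    (hZwL : ∀ i ∈ 𝓛w, cBhatt (fun _ : Unit => P1) i ≤ δ)
    (hZvH : ∀ i ∈ 𝓗v, 1 - δ ≤ cBhatt (fun uw uv => P1 uw * P2 uw uv) i)
    (hZvL : ∀ i ∈ 𝓛v, cBhatt (fun uw uv => P1 uw * P2 uw uv) i ≤ δ)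
    (hZxH : ∀ i ∈ 𝓗x,
      1 - δ ≤ cBhatt (fun uv ux => (∑ uw, P1 uw * P2 uw uv) * P3 uv ux) i)
    (hZxL : ∀ i ∈ 𝓛x,
      cBhatt (fun uv ux => (∑ uw, P1 uw * P2 uw uv) * P3 uv ux) i ≤ δ)
    (qw : ∀ i : Fin N, Unit → (Fin i.val → Bool) → Bool → ℝ)
    (qv : ∀ i : Fin N, (Fin N → Bool) → (Fin i.val → Bool) → Bool → ℝ)
    (qx : ∀ i : Fin N, (Fin N → Bool) → (Fin i.val → Bool) → Bool → ℝ)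
    (hqw : IsPolarEncoderKernel (fun _ : Unit => P1) 𝓗w 𝓛w 𝓡w qw)
    (hqv : IsPolarEncoderKernel (fun uw uv => P1 uw * P2 uw uv) 𝓗v 𝓛v 𝓡v qv)
    (hqx : IsPolarEncoderKernel
      (fun uv ux => (∑ uw, P1 uw * P2 uw uv) * P3 uv ux) 𝓗x 𝓛x 𝓡x qx) :
    ∑ uw : Fin N → Bool, ∑ uv : Fin N → Bool, ∑ ux : Fin N → Bool,
        |P1 uw * P2 uw uv * P3 uv ux -
          (∏ i : Fin N, qw i () (fun j => uw (Fin.castLE i.isLt.le j)) (uw i)) *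
          (∏ i : Fin N, qv i uw (fun j => uv (Fin.castLE i.isLt.le j)) (uv i)) *
          (∏ i : Fin N, qx i uv (fun j => ux (Fin.castLE i.isLt.le j)) (ux i))| ≤
      6 * N * Real.sqrt (Real.log 2 * δ) := by
  have hW2 : ∀ uw uv, 0 ≤ P1 uw * P2 uw uv := fun a b => mul_nonneg (hP10 a) (hP20 a b)
  have hPv : ∀ uv, 0 ≤ ∑ uw, P1 uw * P2 uw uv := fun b => Finset.sum_nonneg fun a _ => hW2 a b
  have hW3 : ∀ uv ux, 0 ≤ (∑ uw, P1 uw * P2 uw uv) * P3 uv ux :=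
    fun a b => mul_nonneg (hPv a) (hP30 a b)
  have s2 : ∑ uw, ∑ uv, P1 uw * P2 uw uv = 1 := by
    simp only [← Finset.mul_sum, hP21, mul_one, hP11]
  have s3 : ∑ uv, ∑ ux, (∑ uw, P1 uw * P2 uw uv) * P3 uv ux = 1 := by
    simp only [← Finset.mul_sum, hP31, mul_one]
    rw [Finset.sum_comm, s2]
  have b1 := layer_bound (fun _ : Unit => P1) (fun _ => hP10) (by simpa using hP11)
    𝓗w 𝓛w 𝓡w hpw δ hδ0 hδ1 hZwH hZwL qw hqw
  have b2 := layer_bound (fun uw uv => P1 uw * P2 uw uv) hW2 s2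
    𝓗v 𝓛v 𝓡v hpv δ hδ0 hδ1 hZvH hZvL qv hqv
  have b3 := layer_bound (fun uv ux => (∑ uw, P1 uw * P2 uw uv) * P3 uv ux) hW3 s3
    𝓗x 𝓛x 𝓡x hpx δ hδ0 hδ1 hZxH hZxL qx hqx
  have kv := kernel_prob _ hW2 𝓗v 𝓛v 𝓡v hpv qv hqv
  have kx := kernel_prob _ hW3 𝓗x 𝓛x 𝓡x hpx qx hqx
  have nv := kprod_nonneg qv (fun i c u => (kv i c u).1)
  have nx := kprod_nonneg qx (fun i c u => (kx i c u).1)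
  have tv := kprod_sum qv (fun i c u => (kv i c u).2)
  have tx := kprod_sum qx (fun i c u => (kx i c u).2)
  simp only [← Finset.mul_sum, hP21, hP31, mul_one, hP11, Finset.univ_unique,
    Finset.sum_singleton, one_mul] at b1 b2 b3
  change ∑ uw : Fin N → Bool, ∑ uv : Fin N → Bool, ∑ ux : Fin N → Bool,
    |P1 uw * P2 uw uv * P3 uv ux - kprod qw () uw * kprod qv uw uv * kprod qx uv ux| ≤ _
  calc ∑ uw : Fin N → Bool, ∑ uv : Fin N → Bool, ∑ ux : Fin N → Bool,
        |P1 uw * P2 uw uv * P3 uv ux - kprod qw () uw * kprod qv uw uv * kprod qx uv ux|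
      ≤ ∑ uw : Fin N → Bool, ∑ uv : Fin N → Bool, ∑ ux : Fin N → Bool,
        (P1 uw * P2 uw uv * |P3 uv ux - kprod qx uv ux| +
          |P1 uw * P2 uw uv - P1 uw * kprod qv uw uv| * kprod qx uv ux +
          |P1 uw - kprod qw () uw| * kprod qv uw uv * kprod qx uv ux) := by
        refine Finset.sum_le_sum fun uw _ => Finset.sum_le_sum fun uv _ =>
          Finset.sum_le_sum fun ux _ => ?_
        have e1 : P1 uw * P2 uw uv * |P3 uv ux - kprod qx uv ux| =
            |P1 uw * P2 uw uv * (P3 uv ux - kprod qx uv ux)| := by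
          rw [abs_mul, abs_of_nonneg (hW2 uw uv)]
        have e2 : |P1 uw * P2 uw uv - P1 uw * kprod qv uw uv| * kprod qx uv ux =
            |(P1 uw * P2 uw uv - P1 uw * kprod qv uw uv) * kprod qx uv ux| := by
          rw [abs_mul, abs_of_nonneg (nx uv ux)]
        have e3 : |P1 uw - kprod qw () uw| * kprod qv uw uv * kprod qx uv ux =
            |(P1 uw - kprod qw () uw) * kprod qv uw uv * kprod qx uv ux| := by
          rw [abs_mul, abs_mul, abs_of_nonneg (nx uv ux), abs_of_nonneg (nv uw uv)]
        rw [e1, e2, e3]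
        refine le_trans (le_of_eq ?_) (abs_add_three _ _ _)
        congr 1; ring
    _ = (∑ uv, ∑ ux, |(∑ uw, P1 uw * P2 uw uv) * P3 uv ux -
            (∑ uw, P1 uw * P2 uw uv) * kprod qx uv ux|) +
          (∑ uw, ∑ uv, |P1 uw * P2 uw uv - P1 uw * kprod qv uw uv|) +
          ∑ uw, |P1 uw - kprod qw () uw| := by
        simp only [Finset.sum_add_distrib]
        congr 1
        · congr 1
          · rw [Finset.sum_comm]
            refine Finset.sum_congr rfl fun uv _ => ?_
            rw [Finset.sum_comm]
            refine Finset.sum_congr rfl fun ux _ => ?_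
            rw [← Finset.sum_mul, ← mul_sub, abs_mul, abs_of_nonneg (hPv uv)]
          · simp only [← Finset.mul_sum, tx, mul_one]
        · simp only [← Finset.mul_sum, tx, tv, mul_one]
    _ ≤ 6 * N * Real.sqrt (Real.log 2 * δ) := by
        have b1' : ∑ uw, |P1 uw - kprod qw () uw| ≤
          N * (2 * Real.sqrt (Real.log 2 * δ)) := b1
        linarith
end
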